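/- Let ξ be an extremal real number with an associated Fibonacci sequence (W_k)_{k≥1} in 𝒫, and let Φ: E* → (𝒫,*) be the morphism of monoids with Φ(b) = W₁ and Φ(a) = W₂. Then there exist constants c₁, c₂ > 0, independent of k, u and v, such that for every k ≥ 1 and every factorization w_k = uv in E*, putting U = Φ(u) and V = Φ(v), one has c₁·‖U‖·‖V‖ ≤ ‖UV‖ ≤ c₂·‖U‖·‖V‖, where UV is the ordinary matrix product. -/

import Mathlib

open Matrix

/-- 2×2 integer matrices. -/
abbrev M2 : Type := Matrix (Fin 2) (Fin 2) ℤ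

/-- The content of an integer matrix: the gcd of its coefficients. -/
def content (A : M2) : ℕ :=
  Nat.gcd (Nat.gcd (A 0 0).natAbs (A 0 1).natAbs) (Nat.gcd (A 1 0).natAbs (A 1 1).natAbs)

/-- A matrix is primitive if its content is 1. -/
def Primitive (A : M2) : Prop := content A = 1

/-- Membership in 𝒫: primitive with nonzero determinant. -/
def MemP (A : M2) : Prop := Primitive A ∧ A.det ≠ 0

/-- `A^red`: the primitive matrix such that `A = content A • A^red`. -/
def red (A : M2) : M2 := Matrix.of fun i j => A i j / (content A : ℤ)

/-- The group operation of 𝒫: `A * B = (AB)^red`. -/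
def pmul (A B : M2) : M2 := red (A * B)

/-- A Fibonacci sequence in 𝒫 (indices from 1). -/
def IsFibP (W : ℕ → M2) : Prop :=
  (∀ i, 1 ≤ i → MemP (W i)) ∧ ∀ i, 1 ≤ i → W (i + 2) = pmul (W (i + 1)) (W i)

/-- Admissibility of a Fibonacci sequence in 𝒫: there is a non-symmetric,
non-skew-symmetric N ∈ 𝒫 such that W_i N_i is symmetric for all i ≥ 1,
where N_i = ᵗN for odd i and N_i = N for even i. -/
def AdmissibleFib (W : ℕ → M2) : Prop :=
  ∃ N : M2, MemP N ∧ N ≠ Nᵀ ∧ N ≠ -Nᵀ ∧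
    ∀ i, 1 ≤ i → (W i * (if i % 2 = 1 then Nᵀ else N)).IsSymm

/-- The norm of an integer 2×2 matrix: max absolute value of coefficients, as a real. -/
noncomputable def mnorm (A : M2) : ℝ :=
  max (max |(A 0 0 : ℝ)| |(A 0 1 : ℝ)|) (max |(A 1 0 : ℝ)| |(A 1 1 : ℝ)|)

/-- The sequence is unbounded in norm. -/
def UnboundedSeq (W : ℕ → M2) : Prop := ∀ C : ℝ, ∃ i, 1 ≤ i ∧ C < mnorm (W i)

/-- The golden ratio γ = (1+√5)/2. -/
noncomputable def gam : ℝ := (1 + Real.sqrt 5) / 2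

/-- Norm of the row vector (ξ, -1)·A. -/
noncomputable def xiNorm (ξ : ℝ) (A : M2) : ℝ :=
  max |ξ * (A 0 0 : ℝ) - (A 1 0 : ℝ)| |ξ * (A 0 1 : ℝ) - (A 1 1 : ℝ)|

/-- ξ is extremal: neither rational nor quadratic over ℚ, and for each X ≥ 1 the system
|x₀| ≤ X, |x₀ξ - x₁| ≤ c X^(-1/γ), |x₀ξ² - x₂| ≤ c X^(-1/γ) has a nonzero integer solution. -/
def IsExtremal (ξ : ℝ) : Prop :=
  (∀ a b c : ℚ, ¬(a = 0 ∧ b = 0 ∧ c = 0) → (a : ℝ) * ξ ^ 2 + (b : ℝ) * ξ + (c : ℝ) ≠ 0) ∧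
  ∃ c : ℝ, 0 < c ∧ ∀ X : ℝ, 1 ≤ X → ∃ x₀ x₁ x₂ : ℤ,
    ¬(x₀ = 0 ∧ x₁ = 0 ∧ x₂ = 0) ∧ |(x₀ : ℝ)| ≤ X ∧
    |(x₀ : ℝ) * ξ - (x₁ : ℝ)| ≤ c * X ^ (-1 / gam) ∧
    |(x₀ : ℝ) * ξ ^ 2 - (x₂ : ℝ)| ≤ c * X ^ (-1 / gam)

/-- The Fibonacci sequence `W` in 𝒫 is associated to the extremal real number ξ:
it is an unbounded admissible Fibonacci sequence in 𝒫 with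
‖W_{i+1}‖ ≍ ‖W_i‖^γ, ‖(ξ,-1)W_i‖ ≍ ‖W_i‖⁻¹ and |det W_i| ≍ 1. -/
def IsAssociated (ξ : ℝ) (W : ℕ → M2) : Prop :=
  IsFibP W ∧ UnboundedSeq W ∧ AdmissibleFib W ∧
  ∃ c₁ c₂ c₃ c₄ c₅ c₆ : ℝ, 0 < c₁ ∧ 0 < c₂ ∧ 0 < c₃ ∧ 0 < c₄ ∧ 0 < c₅ ∧ 0 < c₆ ∧
    ∀ i, 1 ≤ i →
      c₁ * mnorm (W i) ^ gam ≤ mnorm (W (i + 1)) ∧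
      mnorm (W (i + 1)) ≤ c₂ * mnorm (W i) ^ gam ∧
      c₃ * (mnorm (W i))⁻¹ ≤ xiNorm ξ (W i) ∧
      xiNorm ξ (W i) ≤ c₄ * (mnorm (W i))⁻¹ ∧
      c₅ ≤ |((W i).det : ℝ)| ∧ |((W i).det : ℝ)| ≤ c₆

/-- Membership in GL₂(ℤ): integer matrix of determinant ±1. -/
def InGL2Z (A : M2) : Prop := A.det = 1 ∨ A.det = -1

/-- ξ is badly approximable: irrational and |ξ - p/q| > c/q² for all rationals p/q. -/
def BadlyApprox (ξ : ℝ) : Prop :=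
  Irrational ξ ∧ ∃ c : ℝ, 0 < c ∧ ∀ p q : ℤ, q ≠ 0 → c / (q : ℝ) ^ 2 < |ξ - (p : ℝ) / (q : ℝ)|

/-- Partial quotients of the continued fraction expansion: `cfA n ξ` is `aₙ`
where ξ = [a₀, a₁, a₂, …]. -/
noncomputable def cfA : ℕ → ℝ → ℤ
  | 0, ξ => ⌊ξ⌋
  | n + 1, ξ => cfA n (ξ - ⌊ξ⌋)⁻¹

/-- A Fibonacci sequence of words (indices from 1). -/
def FibWordSeq {α : Type} (w : ℕ → List α) : Prop := ∀ i, 1 ≤ i → w (i + 2) = w (i + 1) ++ w i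

/-- `b` (indexed from 1: the limit word is b₁b₂b₃…) is the infinite limit word of the
sequence of words `w`: every `w k` (k ≥ 2) is a prefix of it, and their lengths are unbounded. -/
def IsLimitWord {α : Type} (w : ℕ → List α) (b : ℕ → α) : Prop :=
  (∀ n : ℕ, ∃ k, 2 ≤ k ∧ n ≤ (w k).length) ∧
  ∀ k, 2 ≤ k → ∀ j, (h : j < (w k).length) → (w k).get ⟨j, h⟩ = b (j + 1)

/-- The Fibonacci sequence of words over the alphabet E = {a, b} (with `b = false`,
`a = true`): w₁ = b, w₂ = a, w_{k+2} = w_{k+1} w_k.  Its limit is f_{a,b}. -/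
def fw : ℕ → List Bool
  | 0 => []
  | 1 => [false]
  | 2 => [true]
  | n + 3 => fw (n + 2) ++ fw (n + 1)

/-- The prefix of length `i` of the infinite Fibonacci word `f_{a,b}`
(note `fw (i+2)` is a prefix of `f_{a,b}` of length ≥ i). -/
def fpref (i : ℕ) : List Bool := (fw (i + 2)).take i

/-- The monoid morphism Φ : E* → (𝒫, *) with Φ(b) = W₁, Φ(a) = W₂
(the letter `b` is `false` and `a` is `true`). -/
def PhiW (W1 W2 : M2) : List Bool → M2
  | [] => 1
  | x :: u => pmul (if x then W2 else W1) (PhiW W1 W2 u)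

/-- The set 𝒮₁ of real matrices (a b; c d) with a ≥ max{b,c} and min{b,c} ≥ d ≥ 0. -/
def S1 : Set (Matrix (Fin 2) (Fin 2) ℝ) :=
  {A | max (A 0 1) (A 1 0) ≤ A 0 0 ∧ A 1 1 ≤ min (A 0 1) (A 1 0) ∧ 0 ≤ A 1 1}

/-- The set 𝒮 = 𝒮₁ ∩ GL₂(ℤ), viewed as a set of integer matrices. -/
def Sset : Set M2 :=
  {A | (A.map (Int.cast : ℤ → ℝ)) ∈ S1 ∧ (A.det = 1 ∨ A.det = -1)}

/-- ξ is an extremal real number with an associated Fibonacci sequence in GL₂(ℤ). -/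
def HasGLAssoc (ξ : ℝ) : Prop :=
  IsExtremal ξ ∧ ∃ W : ℕ → M2, IsAssociated ξ W ∧ ∀ i, 1 ≤ i → InGL2Z (W i)

/-- ξ is an extremal real number with an associated Fibonacci sequence in 𝒮. -/
def HasSAssoc (ξ : ℝ) : Prop :=
  IsExtremal ξ ∧ ∃ W : ℕ → M2, IsAssociated ξ W ∧ ∀ i, 1 ≤ i → W i ∈ Sset

/-- Entrywise cast of an integer matrix to a real one. -/
noncomputable def castM : M2 →+* Matrix (Fin 2) (Fin 2) ℝ := (Int.castRingHom ℝ).mapMatrix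

@[simp] lemma castM_apply (A : M2) (i j : Fin 2) : castM A i j = (A i j : ℝ) := rfl

/-- The operator norm on real 2×2 matrices attached to the vector norm
`p ↦ |p₀| + T |p₁ - ξ p₀|`. -/
noncomputable def skewNorm (ξ T : ℝ) (A : Matrix (Fin 2) (Fin 2) ℝ) : ℝ :=
  max (|A 0 0 + ξ * A 0 1| + T * |A 1 0 + ξ * A 1 1 - ξ * (A 0 0 + ξ * A 0 1)|)
    (|A 0 1| / T + |A 1 1 - ξ * A 0 1|)

section skewNorm

variable {ξ T : ℝ} (A B : Matrix (Fin 2) (Fin 2) ℝ)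

lemma skewNorm_nonneg (hT : 0 < T) : 0 ≤ skewNorm ξ T A :=
  le_max_of_le_right (by positivity)

lemma skewNorm_one : skewNorm ξ T 1 = 1 := by
  simp [skewNorm]

lemma skewNorm_smul (r : ℝ) : skewNorm ξ T (r • A) = |r| * skewNorm ξ T A := by
  have h1 : r * A 0 0 + ξ * (r * A 0 1) = r * (A 0 0 + ξ * A 0 1) := by ring
  have h2 : r * A 1 0 + ξ * (r * A 1 1) - ξ * (r * (A 0 0 + ξ * A 0 1)) =
      r * (A 1 0 + ξ * A 1 1 - ξ * (A 0 0 + ξ * A 0 1)) := by ring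
  have h3 : r * A 1 1 - ξ * (r * A 0 1) = r * (A 1 1 - ξ * A 0 1) := by ring
  simp only [skewNorm, Matrix.smul_apply, smul_eq_mul]
  rw [h1, h2, h3, mul_max_of_nonneg _ _ (abs_nonneg r)]
  simp only [abs_mul]
  congr 1 <;> ring

lemma skewNorm_add_le (hT : 0 < T) :
    skewNorm ξ T (A + B) ≤ skewNorm ξ T A + skewNorm ξ T B := by
  refine max_le ?_ ?_
  · refine le_trans ?_ (add_le_add (le_max_left _ _) (le_max_left _ _))
    simp only [Matrix.add_apply]
    have h1 := abs_add_le (A 0 0 + ξ * A 0 1) (B 0 0 + ξ * B 0 1)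
    have h2 := abs_add_le (A 1 0 + ξ * A 1 1 - ξ * (A 0 0 + ξ * A 0 1))
      (B 1 0 + ξ * B 1 1 - ξ * (B 0 0 + ξ * B 0 1))
    have h3 := mul_le_mul_of_nonneg_left h2 hT.le
    ring_nf at h1 h3 ⊢
    linarith
  · refine le_trans ?_ (add_le_add (le_max_right _ _) (le_max_right _ _))
    simp only [Matrix.add_apply]
    have h1 := div_le_div_of_nonneg_right (abs_add_le (A 0 1) (B 0 1)) hT.le
    have h2 := abs_add_le (A 1 1 - ξ * A 0 1) (B 1 1 - ξ * B 0 1)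
    rw [add_div] at h1
    ring_nf at h1 h2 ⊢
    linarith

lemma skewNorm_mul_le (hT : 0 < T) :
    skewNorm ξ T (A * B) ≤ skewNorm ξ T A * skewNorm ξ T B := by
  set p := A 0 0 + ξ * A 0 1 with hp
  set r := A 1 0 + ξ * A 1 1 - ξ * (A 0 0 + ξ * A 0 1) with hr
  set s := A 0 1 with hs
  set t := A 1 1 - ξ * A 0 1 with ht
  have hA1 : |p| + T * |r| ≤ skewNorm ξ T A := le_max_left _ _
  have hA2 : |s| / T + |t| ≤ skewNorm ξ T A := le_max_right _ _
  have key : ∀ x y : ℝ, |x * p + y * s| + T * |x * r + y * t| ≤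
      skewNorm ξ T A * (|x| + T * |y|) := by
    intro x y
    have h1 := abs_add_le (x * p) (y * s)
    have h2 := mul_le_mul_of_nonneg_left (abs_add_le (x * r) (y * t)) hT.le
    simp only [abs_mul] at h1 h2
    have h3 := mul_le_mul_of_nonneg_left hA1 (abs_nonneg x)
    have h4 := mul_le_mul_of_nonneg_left hA2 (mul_nonneg hT.le (abs_nonneg y))
    have h5 : T * |y| * (|s| / T + |t|) = |y| * |s| + T * (|y| * |t|) := by
      field_simp
    nlinarith
  have hN := skewNorm_nonneg (ξ := ξ) A hT
  refine max_le ?_ ?_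
  · refine le_trans ?_ (mul_le_mul_of_nonneg_left (le_max_left _ _) hN)
    refine le_trans (le_of_eq ?_) (key _ _)
    simp only [Matrix.mul_apply, Fin.sum_univ_two, hp, hr, hs, ht]
    ring_nf
  · refine le_trans ?_ (mul_le_mul_of_nonneg_left (le_max_right _ _) hN)
    have h := div_le_div_of_nonneg_right (key (B 0 1) (B 1 1 - ξ * B 0 1)) hT.le
    refine le_trans (le_of_eq ?_) (h.trans (le_of_eq ?_))
    · rw [add_div, mul_div_cancel_left₀ _ hT.ne']
      simp only [Matrix.mul_apply, Fin.sum_univ_two, hp, hr, hs, ht]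
      ring_nf
    · field_simp

lemma skewNorm_le (hT : 0 < T) {M : ℝ} (h : ∀ i j, |A i j| ≤ M) :
    skewNorm ξ T A ≤ (1 + |ξ| + T * (1 + |ξ|) ^ 2 + 1 / T) * M := by
  have hM : 0 ≤ M := (abs_nonneg _).trans (h 0 0)
  have hlin : ∀ x y : ℝ, |x| ≤ M → |y| ≤ M → |x + ξ * y| ≤ (1 + |ξ|) * M := by
    intro x y hx hy
    refine (abs_add_le _ _).trans ?_
    rw [abs_mul]
    nlinarith [mul_le_mul_of_nonneg_left hy (abs_nonneg ξ)]
  have h0 := hlin _ _ (h 0 0) (h 0 1)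
  have h1 := hlin _ _ (h 1 0) (h 1 1)
  have h2 : |A 1 1 - ξ * A 0 1| ≤ (1 + |ξ|) * M := by
    have := hlin (A 1 1) (-A 0 1) (h 1 1) (by rw [abs_neg]; exact h 0 1)
    rwa [mul_neg, ← sub_eq_add_neg] at this
  have h3 : |A 1 0 + ξ * A 1 1 - ξ * (A 0 0 + ξ * A 0 1)| ≤ (1 + |ξ|) ^ 2 * M := by
    refine (abs_sub _ _).trans ?_
    rw [abs_mul]
    nlinarith [mul_le_mul_of_nonneg_left h0 (abs_nonneg ξ)]
  have h4 := mul_le_mul_of_nonneg_left h3 hT.le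
  have h5 : |A 0 1| / T ≤ 1 / T * M := by
    rw [div_mul_eq_mul_div, one_mul]
    exact div_le_div_of_nonneg_right (h 0 1) hT.le
  have h6 : 0 ≤ 1 / T * M := by positivity
  have h7 : 0 ≤ T * ((1 + |ξ|) ^ 2 * M) := by positivity
  refine max_le ?_ ?_ <;> linarith

lemma abs_le_skewNorm (hT : 0 < T) (i j : Fin 2) :
    |A i j| ≤ ((1 + |ξ|) ^ 2 * (1 + T) + 1 / T) * skewNorm ξ T A := by
  set n := skewNorm ξ T A with hn
  have hn0 : 0 ≤ n := skewNorm_nonneg A hT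
  set x := |ξ| with hx
  have hx0 : 0 ≤ x := abs_nonneg ξ
  have hA1 : |A 0 0 + ξ * A 0 1| + T * |A 1 0 + ξ * A 1 1 - ξ * (A 0 0 + ξ * A 0 1)| ≤ n :=
    le_max_left _ _
  have hA2 : |A 0 1| / T + |A 1 1 - ξ * A 0 1| ≤ n := le_max_right _ _
  have hp : |A 0 0 + ξ * A 0 1| ≤ n := by
    have : 0 ≤ T * |A 1 0 + ξ * A 1 1 - ξ * (A 0 0 + ξ * A 0 1)| := by positivity
    linarith
  have hr : |A 1 0 + ξ * A 1 1 - ξ * (A 0 0 + ξ * A 0 1)| ≤ 1 / T * n := by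
    rw [div_mul_eq_mul_div, one_mul, le_div_iff₀ hT]
    linarith [abs_nonneg (A 0 0 + ξ * A 0 1)]
  have hs : |A 0 1| ≤ T * n := by
    have : |A 0 1| / T ≤ n := by linarith [abs_nonneg (A 1 1 - ξ * A 0 1)]
    rwa [div_le_iff₀' hT] at this
  have ht : |A 1 1 - ξ * A 0 1| ≤ n := by
    have : 0 ≤ |A 0 1| / T := by positivity
    linarith
  have hξs : |ξ * A 0 1| ≤ x * (T * n) := by
    rw [abs_mul]; exact mul_le_mul_of_nonneg_left hs hx0
  have h00 : |A 0 0| ≤ n + x * (T * n) := by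
    have := abs_sub (A 0 0 + ξ * A 0 1) (ξ * A 0 1)
    rw [add_sub_cancel_right] at this
    linarith
  have h11 : |A 1 1| ≤ n + x * (T * n) := by
    have := abs_add_le (A 1 1 - ξ * A 0 1) (ξ * A 0 1)
    rw [sub_add_cancel] at this
    linarith
  have h10 : |A 1 0| ≤ 1 / T * n + x * n + x * (n + x * (T * n)) := by
    have e : A 1 0 = (A 1 0 + ξ * A 1 1 - ξ * (A 0 0 + ξ * A 0 1)) +
      (ξ * (A 0 0 + ξ * A 0 1) - ξ * A 1 1) := by ring
    have h1 := abs_add_le (A 1 0 + ξ * A 1 1 - ξ * (A 0 0 + ξ * A 0 1))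
      (ξ * (A 0 0 + ξ * A 0 1) - ξ * A 1 1)
    have h2 := abs_sub (ξ * (A 0 0 + ξ * A 0 1)) (ξ * A 1 1)
    rw [← e] at h1
    rw [abs_mul, abs_mul ξ (A 1 1)] at h2
    have h3 := mul_le_mul_of_nonneg_left hp hx0
    have h4 := mul_le_mul_of_nonneg_left h11 hx0
    linarith
  have t1 : 0 ≤ 1 / T * n := by positivity
  have t2 : 0 ≤ x * n := by positivity
  have t3 : 0 ≤ x * (T * n) := by positivity
  have t4 : 0 ≤ x ^ 2 * n := by positivity
  have t5 : 0 ≤ x ^ 2 * (T * n) := by positivity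
  have t6 : 0 ≤ T * n := by positivity
  fin_cases i <;> fin_cases j <;> simp only [Fin.zero_eta, Fin.mk_one] <;> nlinarith

/-- A product of two nearly rank one matrices whose dominant parts multiply without loss
has nearly the norm allowed by submultiplicativity. -/
lemma skewNorm_mul_skewNorm_le (hT : 0 < T) {Q Q' E E' : Matrix (Fin 2) (Fin 2) ℝ}
    {x x' θ : ℝ} (hA : A = x • Q + E) (hB : B = x' • Q' + E') (hQQ : Q * Q' = θ • Q')
    (hQ : skewNorm ξ T Q = |θ|) (hQ' : skewNorm ξ T Q' = |θ|) :
    skewNorm ξ T A * skewNorm ξ T B ≤ skewNorm ξ T (A * B) +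
      2 * ((skewNorm ξ T A + skewNorm ξ T E) * skewNorm ξ T E') +
      2 * (skewNorm ξ T E * skewNorm ξ T B) := by
  have hneg : ∀ C : Matrix (Fin 2) (Fin 2) ℝ, skewNorm ξ T (-C) = skewNorm ξ T C := by
    intro C
    simpa using skewNorm_smul (ξ := ξ) (T := T) C (-1)
  have nB := skewNorm_nonneg (ξ := ξ) B hT
  have nE := skewNorm_nonneg (ξ := ξ) E hT
  have nE' := skewNorm_nonneg (ξ := ξ) E' hT
  have h1 : skewNorm ξ T A ≤ |x| * |θ| + skewNorm ξ T E := by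
    rw [hA, ← hQ, ← skewNorm_smul]; exact skewNorm_add_le _ _ hT
  have h2 : skewNorm ξ T B ≤ |x'| * |θ| + skewNorm ξ T E' := by
    rw [hB, ← hQ', ← skewNorm_smul]; exact skewNorm_add_le _ _ hT
  have h3 : |x| * |θ| ≤ skewNorm ξ T A + skewNorm ξ T E := by
    rw [← hQ, ← skewNorm_smul, ← hneg E]
    refine le_trans (le_of_eq ?_) (skewNorm_add_le _ _ hT)
    rw [hA, add_neg_cancel_right]
  have h4 : |x| * |θ| * (|x'| * |θ|) ≤ skewNorm ξ T (A * B) + |x| * |θ| * skewNorm ξ T E' +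
      skewNorm ξ T E * skewNorm ξ T B := by
    have e : (x * x' * θ) • Q' = A * B + -((x • Q) * E') + -(E * B) := by
      have : A * B = (x * x' * θ) • Q' + (x • Q) * E' + E * B := by
        conv_lhs => rw [hA, add_mul]
        conv_lhs => rw [hB, mul_add]
        rw [← hB, Matrix.smul_mul, Matrix.mul_smul, hQQ, smul_smul, smul_smul, mul_assoc]
      rw [this]; abel
    have e2 : |x| * |θ| * (|x'| * |θ|) = skewNorm ξ T ((x * x' * θ) • Q') := by
      rw [skewNorm_smul, hQ', abs_mul, abs_mul]; ring
    rw [e2, e]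
    refine (skewNorm_add_le _ _ hT).trans (add_le_add ((skewNorm_add_le _ _ hT).trans ?_) ?_)
    · rw [hneg]
      refine add_le_add le_rfl ((skewNorm_mul_le _ _ hT).trans (le_of_eq ?_))
      rw [skewNorm_smul, hQ]
    · rw [hneg]; exact skewNorm_mul_le _ _ hT
  have h5 := mul_le_mul_of_nonneg_right h1 nB
  have h6 := mul_le_mul_of_nonneg_left h2 (by positivity : 0 ≤ |x| * |θ|)
  have h7 := mul_le_mul_of_nonneg_right h3 nE'
  nlinarith

end skewNorm

lemma abs_le_mnorm (A : M2) (i j : Fin 2) : |(A i j : ℝ)| ≤ mnorm A := by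
  fin_cases i <;> fin_cases j <;> simp [mnorm]

lemma mnorm_le {A : M2} {M : ℝ} (h : ∀ i j, |(A i j : ℝ)| ≤ M) : mnorm A ≤ M :=
  max_le (max_le (h 0 0) (h 0 1)) (max_le (h 1 0) (h 1 1))

lemma one_le_mnorm {A : M2} (hA : A ≠ 0) : 1 ≤ mnorm A := by
  by_contra! h
  refine hA (Matrix.ext fun i j => ?_)
  have h1 := (abs_le_mnorm A i j).trans_lt h
  have h2 : |A i j| < 1 := by exact_mod_cast h1
  simpa using Int.abs_lt_one_iff.mp h2

lemma content_dvd (A : M2) (i j : Fin 2) : (content A : ℤ) ∣ A i j := by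
  rw [Int.natCast_dvd]
  have hl := Nat.gcd_dvd_left (Nat.gcd (A 0 0).natAbs (A 0 1).natAbs)
    (Nat.gcd (A 1 0).natAbs (A 1 1).natAbs)
  have hr := Nat.gcd_dvd_right (Nat.gcd (A 0 0).natAbs (A 0 1).natAbs)
    (Nat.gcd (A 1 0).natAbs (A 1 1).natAbs)
  fin_cases i <;> fin_cases j
  · exact hl.trans (Nat.gcd_dvd_left _ _)
  · exact hl.trans (Nat.gcd_dvd_right _ _)
  · exact hr.trans (Nat.gcd_dvd_left _ _)
  · exact hr.trans (Nat.gcd_dvd_right _ _)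

lemma content_smul_red (A : M2) : (content A : ℤ) • red A = A := by
  ext i j
  simp only [Matrix.smul_apply, smul_eq_mul, red, Matrix.of_apply]
  exact Int.mul_ediv_cancel' (content_dvd A i j)

lemma content_pos {A : M2} (hA : A ≠ 0) : 0 < content A := by
  refine Nat.pos_of_ne_zero fun h => hA ?_
  rw [← content_smul_red A, h]; simp

lemma content_smul_castM_red (A : M2) : (content A : ℝ) • castM (red A) = castM A := by
  ext i j
  have := congrFun (congrFun (content_smul_red A) i) j
  simp only [Matrix.smul_apply, smul_eq_mul, castM_apply] at this ⊢
  exact_mod_cast this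

lemma det_red_ne_zero {A : M2} (hA : A.det ≠ 0) : (red A).det ≠ 0 := by
  intro h
  apply hA
  rw [← content_smul_red A, Matrix.det_smul, h, mul_zero]

lemma ne_zero_of_det_ne_zero {A : M2} (hA : A.det ≠ 0) : A ≠ 0 := by
  rintro rfl; simp at hA

section PhiW

variable {W1 W2 : M2}

lemma det_PhiW_ne_zero (h1 : W1.det ≠ 0) (h2 : W2.det ≠ 0) (u : List Bool) :
    (PhiW W1 W2 u).det ≠ 0 := by
  induction u with
  | nil => simp [PhiW]
  | cons x u ih =>
    refine det_red_ne_zero ?_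
    rw [Matrix.det_mul]
    exact mul_ne_zero (by split_ifs <;> assumption) ih

lemma castM_PhiW_append (h1 : W1.det ≠ 0) (h2 : W2.det ≠ 0) (u v : List Bool) :
    ∃ s : ℝ, 0 < s ∧
      castM (PhiW W1 W2 u) * castM (PhiW W1 W2 v) = s • castM (PhiW W1 W2 (u ++ v)) := by
  induction u with
  | nil => exact ⟨1, one_pos, by simp [PhiW]⟩
  | cons x u ih =>
    obtain ⟨s, hs, h⟩ := ih
    set X := if x then W2 else W1 with hX
    have hXd : X.det ≠ 0 := by rw [hX]; split_ifs <;> assumption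
    have hpos : ∀ u, 0 < (content (X * PhiW W1 W2 u) : ℝ) := fun u => by
      refine Nat.cast_pos.mpr (content_pos (ne_zero_of_det_ne_zero ?_))
      rw [Matrix.det_mul]
      exact mul_ne_zero hXd (det_PhiW_ne_zero h1 h2 u)
    have hm := content_smul_castM_red (X * PhiW W1 W2 u)
    have hn := content_smul_castM_red (X * PhiW W1 W2 (u ++ v))
    have pm := hpos u
    have pn := hpos (u ++ v)
    change ∃ s : ℝ, 0 < s ∧ castM (red (X * PhiW W1 W2 u)) * castM (PhiW W1 W2 v) =
      s • castM (red (X * PhiW W1 W2 (u ++ v)))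
    set m : ℝ := (content (X * PhiW W1 W2 u) : ℝ)
    set n : ℝ := (content (X * PhiW W1 W2 (u ++ v)) : ℝ)
    refine ⟨m⁻¹ * (s * n), by positivity, ?_⟩
    have e : m • (castM (red (X * PhiW W1 W2 u)) * castM (PhiW W1 W2 v)) =
        (s * n) • castM (red (X * PhiW W1 W2 (u ++ v))) := by
      rw [← Matrix.smul_mul, hm, mul_smul, hn, map_mul, map_mul, mul_assoc, h, Matrix.mul_smul]
    rw [mul_smul, ← e, smul_smul, inv_mul_cancel₀ pm.ne', one_smul]

lemma castM_PhiW_fw {W : ℕ → M2} (hW : IsFibP W) (n : ℕ) :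
    ∃ s : ℝ, 0 < s ∧ castM (PhiW (W 1) (W 2) (fw (n + 1))) = s • castM (W (n + 1)) := by
  have hdet : ∀ i, 1 ≤ i → (W i).det ≠ 0 := fun i hi => (hW.1 i hi).2
  have hsingle : ∀ A : M2, A.det ≠ 0 → ∃ s : ℝ, 0 < s ∧ castM (pmul A 1) = s • castM A := by
    intro A hA
    have hc : 0 < (content A : ℝ) := Nat.cast_pos.mpr (content_pos (ne_zero_of_det_ne_zero hA))
    refine ⟨(content A : ℝ)⁻¹, by positivity, ?_⟩
    rw [pmul, mul_one]
    have h := congrArg (fun M => (content A : ℝ)⁻¹ • M) (content_smul_castM_red A)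
    rwa [smul_smul, inv_mul_cancel₀ hc.ne', one_smul] at h
  induction n using Nat.twoStepInduction with
  | zero => simpa [fw, PhiW] using hsingle (W 1) (hdet 1 le_rfl)
  | one => simpa [fw, PhiW] using hsingle (W 2) (hdet 2 one_le_two)
  | more n ih1 ih2 =>
    obtain ⟨s, hs, h1⟩ := ih1
    obtain ⟨t, ht, h2⟩ := ih2
    obtain ⟨r, hr, h⟩ := castM_PhiW_append (hdet 1 le_rfl) (hdet 2 one_le_two)
      (fw (n + 2)) (fw (n + 1))
    have hP := content_smul_castM_red (W (n + 2) * W (n + 1))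
    have hc : 0 < (content (W (n + 2) * W (n + 1)) : ℝ) := by
      refine Nat.cast_pos.mpr (content_pos (ne_zero_of_det_ne_zero ?_))
      rw [Matrix.det_mul]
      exact mul_ne_zero (hdet _ (by omega)) (hdet _ (by omega))
    set c : ℝ := (content (W (n + 2) * W (n + 1)) : ℝ)
    refine ⟨r⁻¹ * (t * s * c), by positivity, ?_⟩
    have e : W (n + 2 + 1) = red (W (n + 2) * W (n + 1)) := hW.2 (n + 1) (by omega)
    rw [e, mul_smul, mul_smul, hP, map_mul]
    rw [h1, h2, Matrix.smul_mul, Matrix.mul_smul, smul_smul] at h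
    rw [h, smul_smul, inv_mul_cancel₀ hr.ne', one_smul]
    rfl

/-- If a norm is multiplicative on consecutive terms of a Fibonacci sequence up to factors
`1 + ε n`, it is multiplicative on factorizations of Fibonacci words up to the product of
these factors. -/
lemma skewNorm_PhiW_mul_le {W : ℕ → M2} (hW : IsFibP W) {ξ T : ℝ} (hT : 0 < T) {ε : ℕ → ℝ}
    (hε : ∀ n, 0 ≤ ε n)
    (h : ∀ n, 1 ≤ n → skewNorm ξ T (castM (W (n + 1))) * skewNorm ξ T (castM (W n)) ≤
      (1 + ε n) * skewNorm ξ T (castM (W (n + 1)) * castM (W n)))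
    (n : ℕ) : ∀ u v : List Bool, fw (n + 1) = u ++ v →
      skewNorm ξ T (castM (PhiW (W 1) (W 2) u)) * skewNorm ξ T (castM (PhiW (W 1) (W 2) v)) ≤
      (∏ j ∈ Finset.range n, (1 + ε j)) *
        skewNorm ξ T (castM (PhiW (W 1) (W 2) u) * castM (PhiW (W 1) (W 2) v)) := by
  have hd1 : (W 1).det ≠ 0 := (hW.1 1 le_rfl).2
  have hd2 : (W 2).det ≠ 0 := (hW.1 2 one_le_two).2
  have hprod : ∀ n, 1 ≤ ∏ j ∈ Finset.range n, (1 + ε j) := fun n =>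
    Finset.prod_induction _ (fun x => 1 ≤ x) (fun _ _ => one_le_mul_of_one_le_of_one_le) le_rfl
      fun j _ => by linarith [hε j]
  have hsingle : ∀ (c : ℝ) (x : Bool), 1 ≤ c → ∀ u v : List Bool, [x] = u ++ v →
      skewNorm ξ T (castM (PhiW (W 1) (W 2) u)) * skewNorm ξ T (castM (PhiW (W 1) (W 2) v)) ≤
      c * skewNorm ξ T (castM (PhiW (W 1) (W 2) u) * castM (PhiW (W 1) (W 2) v)) := by
    intro c x hc u v huv
    rcases List.append_eq_singleton_iff.mp huv.symm with ⟨rfl, -⟩ | ⟨-, rfl⟩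
    · simp only [PhiW, map_one, one_mul, skewNorm_one]
      exact le_mul_of_one_le_left (skewNorm_nonneg _ hT) hc
    · simp only [PhiW, map_one, mul_one, skewNorm_one]
      exact le_mul_of_one_le_left (skewNorm_nonneg _ hT) hc
  induction n using Nat.twoStepInduction with
  | zero => exact hsingle _ _ (hprod 0)
  | one => exact hsingle _ _ (hprod 1)
  | more n ih1 ih2 =>
    intro u v huv
    have huv' : fw (n + 2) ++ fw (n + 1) = u ++ v := huv
    set P : List Bool → Matrix (Fin 2) (Fin 2) ℝ := fun u => castM (PhiW (W 1) (W 2) u) with hPdef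
    change skewNorm ξ T (P u) * skewNorm ξ T (P v) ≤ _ * skewNorm ξ T (P u * P v)
    have happ : ∀ u v, ∃ s : ℝ, 0 < s ∧ P u * P v = s • P (u ++ v) :=
      castM_PhiW_append hd1 hd2
    have hfib : skewNorm ξ T (P (fw (n + 2))) * skewNorm ξ T (P (fw (n + 1))) ≤
        (1 + ε (n + 1)) * skewNorm ξ T (P (fw (n + 2)) * P (fw (n + 1))) := by
      obtain ⟨s, hs, h1⟩ := castM_PhiW_fw hW n
      obtain ⟨t, ht, h2⟩ := castM_PhiW_fw hW (n + 1)
      have := mul_le_mul_of_nonneg_left (h (n + 1) (by omega)) (mul_pos ht hs).le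
      simp only [hPdef, h1, h2, Matrix.smul_mul, Matrix.mul_smul, skewNorm_smul, abs_of_pos hs,
        abs_of_pos ht] at this ⊢
      nlinarith
    have hassoc : ∀ A B C : Matrix (Fin 2) (Fin 2) ℝ, ∀ g e : ℝ, 0 ≤ g →
        skewNorm ξ T B * skewNorm ξ T C ≤ g * skewNorm ξ T (B * C) →
        skewNorm ξ T A * skewNorm ξ T (B * C) ≤ e * skewNorm ξ T (A * (B * C)) →
        skewNorm ξ T (A * B) * skewNorm ξ T C ≤ g * e * skewNorm ξ T (A * B * C) := by
      intro A B C g e hg h1 h2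
      have h3 := mul_le_mul_of_nonneg_right (skewNorm_mul_le (ξ := ξ) A B hT)
        (skewNorm_nonneg (ξ := ξ) C hT)
      have h4 := mul_le_mul_of_nonneg_left h1 (skewNorm_nonneg (ξ := ξ) A hT)
      have h5 := mul_le_mul_of_nonneg_left h2 hg
      rw [mul_assoc A]
      linarith
    have hassoc' : ∀ A B C : Matrix (Fin 2) (Fin 2) ℝ, ∀ g e : ℝ, 0 ≤ g →
        skewNorm ξ T A * skewNorm ξ T B ≤ g * skewNorm ξ T (A * B) →
        skewNorm ξ T (A * B) * skewNorm ξ T C ≤ e * skewNorm ξ T (A * B * C) →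
        skewNorm ξ T A * skewNorm ξ T (B * C) ≤ g * e * skewNorm ξ T (A * (B * C)) := by
      intro A B C g e hg h1 h2
      have h3 := mul_le_mul_of_nonneg_left (skewNorm_mul_le (ξ := ξ) B C hT)
        (skewNorm_nonneg (ξ := ξ) A hT)
      have h4 := mul_le_mul_of_nonneg_right h1 (skewNorm_nonneg (ξ := ξ) C hT)
      have h5 := mul_le_mul_of_nonneg_left h2 hg
      rw [← mul_assoc A]
      linarith
    rw [Finset.prod_range_succ]
    rcases List.append_eq_append_iff.mp huv' with ⟨a, rfl, hv⟩ | ⟨a, hu, rfl⟩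
    · obtain ⟨s, hs, h1⟩ := happ (fw (n + 2)) a
      obtain ⟨t, ht, h2⟩ := happ a v
      rw [← hv] at h2
      have h3 := hassoc (P (fw (n + 2))) (P a) (P v) _ (1 + ε (n + 1))
        (zero_le_one.trans (hprod n)) (ih1 a v hv) (by
          rw [h2, Matrix.mul_smul, skewNorm_smul, skewNorm_smul]
          have := mul_le_mul_of_nonneg_left hfib (abs_nonneg t)
          linarith)
      rw [h1, Matrix.smul_mul, skewNorm_smul, skewNorm_smul, abs_of_pos hs, mul_assoc,
        mul_left_comm _ s, mul_le_mul_iff_right₀ hs] at h3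
      refine h3.trans (mul_le_mul_of_nonneg_right ?_ (skewNorm_nonneg _ hT))
      refine mul_le_mul_of_nonneg_right ?_ (by linarith [hε (n + 1)])
      rw [Finset.prod_range_succ]
      exact le_mul_of_one_le_right (zero_le_one.trans (hprod n)) (by linarith [hε n])
    · obtain ⟨s, hs, h1⟩ := happ u a
      obtain ⟨t, ht, h2⟩ := happ a (fw (n + 1))
      rw [← hu] at h1
      have h3 := hassoc' (P u) (P a) (P (fw (n + 1))) _ (1 + ε (n + 1))
        (zero_le_one.trans (hprod (n + 1))) (ih2 u a hu) (by
          rw [h1, Matrix.smul_mul, skewNorm_smul, skewNorm_smul]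
          have := mul_le_mul_of_nonneg_left hfib (abs_nonneg s)
          linarith)
      rwa [h2, Matrix.mul_smul, skewNorm_smul, skewNorm_smul, abs_of_pos ht,
        mul_left_comm _ t, mul_left_comm _ t, mul_le_mul_iff_right₀ ht] at h3

end PhiW


/-- The product of the column `(1, ξ)` and the row `(1, ξ) adj(N)`. -/
noncomputable def rankOne (ξ : ℝ) (N : M2) : Matrix (Fin 2) (Fin 2) ℝ :=
  !![N 1 1 - ξ * N 1 0, ξ * N 0 0 - N 0 1;
    ξ * (N 1 1 - ξ * N 1 0), ξ * (ξ * N 0 0 - N 0 1)]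

/-- The value at `(1, ξ)` of the quadratic form with matrix `adj(N)`. -/
noncomputable def adjForm (ξ : ℝ) (N : M2) : ℝ :=
  N 0 0 * ξ ^ 2 - (N 0 1 + N 1 0) * ξ + N 1 1

lemma adjForm_transpose (ξ : ℝ) (N : M2) : adjForm ξ Nᵀ = adjForm ξ N := by
  simp only [adjForm, Matrix.transpose_apply]; ring

lemma adjForm_ne_zero {ξ : ℝ} (hξ : IsExtremal ξ) {N : M2} (hN : N ≠ -Nᵀ) :
    adjForm ξ N ≠ 0 := by
  have h := hξ.1 (N 0 0 : ℚ) (-(N 0 1 + N 1 0) : ℚ) (N 1 1 : ℚ) (by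
    rintro ⟨h1, h2, h3⟩
    have h1' : N 0 0 = 0 := by exact_mod_cast h1
    have h2' : -(N 0 1 + N 1 0) = 0 := by exact_mod_cast h2
    have h3' : N 1 1 = 0 := by exact_mod_cast h3
    apply hN
    ext i j
    fin_cases i <;> fin_cases j <;>
      simp only [Fin.zero_eta, Fin.mk_one, Matrix.neg_apply, Matrix.transpose_apply] <;> omega)
  convert h using 1
  simp only [adjForm]
  push_cast
  ring

lemma rankOne_mul_rankOne (ξ : ℝ) (N M : M2) :
    rankOne ξ N * rankOne ξ M = adjForm ξ N • rankOne ξ M := by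
  ext i j
  fin_cases i <;> fin_cases j <;>
    simp [rankOne, adjForm, Matrix.mul_apply, Fin.sum_univ_two] <;> ring

lemma skewNorm_rankOne {ξ T : ℝ} (hT : 0 < T) {N : M2}
    (h : |ξ * N 0 0 - N 0 1| ≤ T * |adjForm ξ N|) :
    skewNorm ξ T (rankOne ξ N) = |adjForm ξ N| := by
  have h1 : (N 1 1 - ξ * N 1 0) + ξ * (ξ * N 0 0 - N 0 1) = adjForm ξ N := by
    simp only [adjForm]; ring
  have h2 : |ξ * N 0 0 - N 0 1| / T ≤ |adjForm ξ N| := by rwa [div_le_iff₀' hT]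
  have h3 : ξ * (N 1 1 - ξ * N 1 0) + ξ * (ξ * (ξ * N 0 0 - N 0 1)) - ξ * adjForm ξ N = 0 := by
    rw [← h1]; ring
  simp [skewNorm, rankOne, h1, h2, h3]

lemma mnorm_transpose (N : M2) : mnorm Nᵀ = mnorm N :=
  le_antisymm (mnorm_le fun i j => abs_le_mnorm N j i) (mnorm_le fun i j => abs_le_mnorm Nᵀ j i)

/-- If `W N` is symmetric and `(ξ, -1) W` is small, then `W` is close to a multiple of
`rankOne ξ N`. -/
lemma exists_castM_eq_smul_rankOne_add {ξ δ : ℝ} {W N : M2} (hWN : (W * N).IsSymm)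
    (hN : N.det ≠ 0) (hW : xiNorm ξ W ≤ δ) :
    ∃ (x : ℝ) (E : Matrix (Fin 2) (Fin 2) ℝ), castM W = x • rankOne ξ N + E ∧
      ∀ i j, |E i j| ≤ (2 * (1 + |ξ|) * mnorm N ^ 2 + 1) * δ := by
  set D : ℝ := N 0 0 * N 1 1 - N 0 1 * N 1 0 with hD
  have hDdet : D = (N.det : ℝ) := by rw [Matrix.det_fin_two, hD]; push_cast; ring
  have hD1 : 1 ≤ |D| := by rw [hDdet]; exact_mod_cast Int.one_le_abs hN
  have hD0 : D ≠ 0 := abs_pos.mp (zero_lt_one.trans_le hD1)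
  set α : ℝ := ξ * W 0 0 - W 1 0 with hα
  set β : ℝ := ξ * W 0 1 - W 1 1 with hβ
  have hαδ : |α| ≤ δ := (le_max_left _ _).trans hW
  have hβδ : |β| ≤ δ := (le_max_right _ _).trans hW
  have hδ : 0 ≤ δ := (abs_nonneg _).trans hαδ
  have hn : 0 ≤ mnorm N := (abs_nonneg _).trans (abs_le_mnorm N 0 0)
  set ρ : ℝ := α * N 0 0 + β * N 1 0 with hρ
  set s : ℝ := W 0 0 * N 0 0 + W 0 1 * N 1 0 with hs
  have hsym : (W 0 0 * N 0 1 + W 0 1 * N 1 1 : ℝ) = W 1 0 * N 0 0 + W 1 1 * N 1 0 := by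
    have := hWN.apply 1 0
    simp only [Matrix.mul_apply, Fin.sum_univ_two] at this
    exact_mod_cast this
  have ha : (W 0 0 : ℝ) * D = s * (N 1 1 - ξ * N 1 0) + ρ * N 1 0 := by
    rw [hD, hs, hρ, hα, hβ]; linear_combination (-(N 1 0 : ℝ)) * hsym
  have hb : (W 0 1 : ℝ) * D = s * (ξ * N 0 0 - N 0 1) - ρ * N 0 0 := by
    rw [hD, hs, hρ, hα, hβ]; linear_combination (N 0 0 : ℝ) * hsym
  have hρδ : |ρ| ≤ 2 * mnorm N * δ := by
    refine (abs_add_le _ _).trans ?_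
    rw [abs_mul, abs_mul]
    have h1 := mul_le_mul hαδ (abs_le_mnorm N 0 0) (abs_nonneg _) hδ
    have h2 := mul_le_mul hβδ (abs_le_mnorm N 1 0) (abs_nonneg _) hδ
    linarith
  have hsmall : ∀ i j, |ρ * N i j / D| ≤ 2 * mnorm N ^ 2 * δ := by
    intro i j
    rw [abs_div, abs_mul]
    refine (div_le_self (by positivity) hD1).trans ?_
    have := mul_le_mul hρδ (abs_le_mnorm N i j) (abs_nonneg _) (by positivity)
    linarith
  have h00 : (W 0 0 : ℝ) = s / D * (N 1 1 - ξ * N 1 0) + ρ * N 1 0 / D := by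
    field_simp; linarith
  have h01 : (W 0 1 : ℝ) = s / D * (ξ * N 0 0 - N 0 1) + -(ρ * N 0 0 / D) := by
    field_simp; linarith
  have h10 : (W 1 0 : ℝ) = ξ * W 0 0 - α := by rw [hα]; ring
  have h11 : (W 1 1 : ℝ) = ξ * W 0 1 - β := by rw [hβ]; ring
  have hg := hsmall 1 0
  have he := hsmall 0 0
  have hp : 0 ≤ mnorm N ^ 2 * δ := by positivity
  have hq : 0 ≤ |ξ| * (mnorm N ^ 2 * δ) := by positivity
  refine ⟨s / D, !![ρ * N 1 0 / D, -(ρ * N 0 0 / D);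
    ξ * (ρ * N 1 0 / D) - α, ξ * -(ρ * N 0 0 / D) - β], ?_, ?_⟩
  · ext i j
    fin_cases i <;> fin_cases j <;>
      simp only [Fin.zero_eta, Fin.mk_one, castM_apply, Matrix.add_apply, Matrix.smul_apply,
        rankOne, smul_eq_mul, Matrix.of_apply, Matrix.cons_val', Matrix.cons_val_zero,
        Matrix.cons_val_one, Matrix.cons_val_fin_one]
    · exact h00
    · exact h01
    · rw [h10, h00]; ring
    · rw [h11, h01]; ring
  · have hK : (2 * (1 + |ξ|) * mnorm N ^ 2 + 1) * δ =
        2 * (mnorm N ^ 2 * δ) + 2 * (|ξ| * (mnorm N ^ 2 * δ)) + δ := by ring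
    have hrow : ∀ x y, |x| ≤ 2 * mnorm N ^ 2 * δ → |y| ≤ δ →
        |ξ * x - y| ≤ (2 * (1 + |ξ|) * mnorm N ^ 2 + 1) * δ := by
      intro x y hx hy
      have h := abs_sub (ξ * x) y
      rw [abs_mul] at h
      have := mul_le_mul_of_nonneg_left hx (abs_nonneg ξ)
      rw [hK]
      linarith
    have hrow' : ∀ x, |x| ≤ 2 * mnorm N ^ 2 * δ →
        |x| ≤ (2 * (1 + |ξ|) * mnorm N ^ 2 + 1) * δ := by
      intro x hx
      rw [hK]
      linarith
    rw [← abs_neg] at he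
    intro i j
    fin_cases i <;> fin_cases j <;>
      simp only [Fin.zero_eta, Fin.mk_one, Matrix.of_apply, Matrix.cons_val',
        Matrix.cons_val_zero, Matrix.cons_val_one, Matrix.cons_val_fin_one]
    · exact hrow' _ hg
    · exact hrow' _ he
    · exact hrow _ _ hg hαδ
    · exact hrow _ _ he hβδ

lemma gam_sq : gam ^ 2 = gam + 1 := Real.goldenRatio_sq

lemma one_lt_gam : 1 < gam := Real.one_lt_goldenRatio

lemma mul_le_of_growth {w : ℕ → ℝ} {c : ℝ} (hc : 0 < c) (hw : ∀ i, 1 ≤ i → 1 ≤ w i)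
    (hgrow : ∀ i, 1 ≤ i → c * w i ^ gam ≤ w (i + 1)) (i : ℕ) (hi : 1 ≤ i) :
    c * c ^ (gam - 1) * (w (i + 1) * w i) ≤ w (i + 2) := by
  have hg : 0 ≤ gam - 1 := by linarith [one_lt_gam]
  have h1 := hw i hi
  have h2 := hw (i + 1) (by omega)
  have hpos : 0 < w i ^ gam := Real.rpow_pos_of_pos (by linarith) _
  have h3 := Real.rpow_le_rpow (by positivity) (hgrow i hi) hg
  rw [Real.mul_rpow hc.le hpos.le, ← Real.rpow_mul (by linarith),
    show gam * (gam - 1) = 1 by linarith [gam_sq], Real.rpow_one] at h3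
  have h4 : w (i + 1) ^ gam = w (i + 1) * w (i + 1) ^ (gam - 1) := by
    conv_lhs => rw [show gam = 1 + (gam - 1) by ring, Real.rpow_add (by linarith), Real.rpow_one]
  have h5 := hgrow (i + 1) (by omega)
  rw [h4] at h5
  refine le_trans ?_ h5
  have := mul_le_mul_of_nonneg_left h3 (by positivity : 0 ≤ c * w (i + 1))
  linarith

lemma summable_inv_sq_of_growth {w : ℕ → ℝ} {c : ℝ} (hc : 0 < c) (hw : ∀ i, 1 ≤ i → 1 ≤ w i)
    (hgrow : ∀ i, 1 ≤ i → c * w i ^ gam ≤ w (i + 1))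
    (hub : ∀ C : ℝ, ∃ i, 1 ≤ i ∧ C < w i) :
    Summable fun i => 1 / w i ^ 2 := by
  have hg : 0 < gam - 1 := by linarith [one_lt_gam]
  obtain ⟨i, hi, hiC⟩ := hub ((2 / c) ^ gam)
  have hstep : ∀ j, 1 ≤ j → (2 / c) ^ gam < w j → 2 * w j ≤ w (j + 1) := by
    intro j hj hjC
    have h1 := hw j hj
    have h3 := Real.rpow_le_rpow (by positivity) hjC.le hg.le
    rw [← Real.rpow_mul (by positivity), show gam * (gam - 1) = 1 by linarith [gam_sq],
      Real.rpow_one, div_le_iff₀' hc] at h3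
    have h4 : w j ^ gam = w j * w j ^ (gam - 1) := by
      conv_lhs => rw [show gam = 1 + (gam - 1) by ring, Real.rpow_add (by linarith), Real.rpow_one]
    have h5 := hgrow j hj
    rw [h4] at h5
    nlinarith
  have hpow : ∀ n, (2 / c) ^ gam < w (n + i) ∧ 2 ^ n ≤ w (n + i) := by
    intro n
    induction n with
    | zero => simpa using ⟨hiC, hw i hi⟩
    | succ n ih =>
      have h := hstep (n + i) (by omega) ih.1
      have h1 := hw (n + i) (by omega)
      rw [show n + 1 + i = n + i + 1 by ring]
      exact ⟨by linarith [ih.1], by rw [pow_succ]; linarith [ih.2]⟩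
  refine (summable_nat_add_iff i).mp ?_
  refine Summable.of_nonneg_of_le (fun n => by positivity) (fun n => ?_)
    (summable_geometric_of_lt_one (by norm_num : (0 : ℝ) ≤ 1 / 2) (by norm_num))
  rw [div_pow, one_pow]
  have h1 := hw (n + i) (by omega)
  exact one_div_le_one_div_of_le (by positivity) ((hpow n).2.trans (by nlinarith))

lemma exists_skewNorm_mul_skewNorm_le {ξ : ℝ} {W : ℕ → M2} (hξ : IsExtremal ξ)
    (hW : IsAssociated ξ W) :
    ∃ T K : ℝ, 0 < T ∧ 0 ≤ K ∧ ∀ n, 1 ≤ n →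
      skewNorm ξ T (castM (W (n + 1))) * skewNorm ξ T (castM (W n)) ≤
      (1 + K * (1 / mnorm (W n) ^ 2)) * skewNorm ξ T (castM (W (n + 1)) * castM (W n)) := by
  obtain ⟨hfib, -, ⟨N, hNP, -, hN, hsym⟩, c₁, c₂, c₃, c₄, c₅, c₆, hc₁, -, -, hc₄, -, -, hb⟩ := hW
  set θ := adjForm ξ N with hθ
  have hθ0 : 0 < |θ| := abs_pos.mpr (adjForm_ne_zero hξ hN)
  set T : ℝ := (|ξ * N 0 0 - N 0 1| + |ξ * N 0 0 - N 1 0|) / |θ| + 1 with hTdef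
  have hT : 0 < T := by positivity
  have hTθ : T * |θ| = |ξ * N 0 0 - N 0 1| + |ξ * N 0 0 - N 1 0| + |θ| := by
    rw [hTdef]; field_simp
  set M : ℕ → M2 := fun i => if i % 2 = 1 then Nᵀ else N with hM
  have hMform : ∀ i, adjForm ξ (M i) = θ := by
    intro i
    simp only [hM]
    split_ifs
    exacts [adjForm_transpose ξ N, rfl]
  have hMmnorm : ∀ i, mnorm (M i) = mnorm N := by
    intro i
    simp only [hM]
    split_ifs
    exacts [mnorm_transpose N, rfl]
  have hMdet : ∀ i, (M i).det ≠ 0 := by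
    intro i
    simp only [hM]
    split_ifs
    exacts [by rw [Matrix.det_transpose]; exact hNP.2, hNP.2]
  have hQ : ∀ i, skewNorm ξ T (rankOne ξ (M i)) = |θ| := by
    intro i
    rw [← hMform i]
    refine skewNorm_rankOne hT ?_
    rw [hMform i, hTθ]
    have h1 := abs_nonneg (ξ * N 0 0 - N 0 1)
    have h2 := abs_nonneg (ξ * N 0 0 - N 1 0)
    simp only [hM]
    split_ifs
    · simp only [Matrix.transpose_apply]; linarith
    · linarith
  have hw : ∀ i, 1 ≤ i → 1 ≤ mnorm (W i) := fun i hi =>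
    one_le_mnorm (ne_zero_of_det_ne_zero (hfib.1 i hi).2)
  set C : ℝ := 1 + |ξ| + T * (1 + |ξ|) ^ 2 + 1 / T with hC
  set C' : ℝ := (1 + |ξ|) ^ 2 * (1 + T) + 1 / T with hC'
  have hC0 : 0 < C := by positivity
  have hC'0 : 0 < C' := by positivity
  set e : ℝ := (2 * (1 + |ξ|) * mnorm N ^ 2 + 1) * c₄ with he
  have he0 : 0 < e := by positivity
  have hdecomp : ∀ i, 1 ≤ i → ∃ (x : ℝ) (E : Matrix (Fin 2) (Fin 2) ℝ),
      castM (W i) = x • rankOne ξ (M i) + E ∧ skewNorm ξ T E ≤ C * (e / mnorm (W i)) := by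
    intro i hi
    obtain ⟨x, E, h, hE⟩ :=
      exists_castM_eq_smul_rankOne_add (hsym i hi) (hMdet i) (hb i hi).2.2.2.1
    refine ⟨x, E, h, skewNorm_le _ hT fun i j => (hE i j).trans (le_of_eq ?_)⟩
    change (2 * (1 + |ξ|) * mnorm (M _) ^ 2 + 1) * _ = _
    rw [hMmnorm, he]; ring
  set d : ℝ := c₁ * c₁ ^ (gam - 1) / C' with hd
  have hd0 : 0 < d := div_pos (mul_pos hc₁ (Real.rpow_pos_of_pos hc₁ _)) hC'0
  set L : ℝ := 2 * C ^ 2 * e * (1 + e) + 2 * C ^ 2 * e / c₁ ^ 2 with hL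
  have hL0 : 0 < L := by positivity
  refine ⟨T, L / d, hT, by positivity, fun n hn => ?_⟩
  obtain ⟨x, E, hA, hE⟩ := hdecomp (n + 1) (by omega)
  obtain ⟨x', E', hB, hE'⟩ := hdecomp n hn
  have hmain := skewNorm_mul_skewNorm_le (castM (W (n + 1))) (castM (W n)) hT hA hB
    (by rw [rankOne_mul_rankOne, hMform]) (hQ _) (hQ _)
  have hAn : skewNorm ξ T (castM (W (n + 1))) ≤ C * mnorm (W (n + 1)) :=
    skewNorm_le _ hT (abs_le_mnorm _)
  have hBn : skewNorm ξ T (castM (W n)) ≤ C * mnorm (W n) := skewNorm_le _ hT (abs_le_mnorm _)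
  have hlow : d * (mnorm (W (n + 1)) * mnorm (W n)) ≤
      skewNorm ξ T (castM (W (n + 1)) * castM (W n)) := by
    have h1 := mul_le_of_growth (w := fun i => mnorm (W i)) hc₁ hw (fun i hi => (hb i hi).1) n hn
    have h2 : mnorm (W (n + 2)) ≤ C' * skewNorm ξ T (castM (W (n + 2))) :=
      mnorm_le (abs_le_skewNorm (castM (W (n + 2))) hT)
    have h3 := content_smul_castM_red (W (n + 1) * W n)
    have h4 : 1 ≤ (content (W (n + 1) * W n) : ℝ) := by
      refine Nat.one_le_cast.mpr (content_pos (ne_zero_of_det_ne_zero ?_))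
      rw [Matrix.det_mul]
      exact mul_ne_zero (hfib.1 _ (by omega)).2 (hfib.1 _ hn).2
    have h5 : W (n + 2) = red (W (n + 1) * W n) := hfib.2 n hn
    rw [← h5] at h3
    rw [← map_mul, ← h3, skewNorm_smul, abs_of_nonneg (by linarith)]
    refine le_trans ?_ (le_mul_of_one_le_left (skewNorm_nonneg _ hT) h4)
    rw [hd, div_mul_eq_mul_div, div_le_iff₀' hC'0]
    exact h1.trans h2
  have hw1 := hw n hn
  have hw2 := hw (n + 1) (by omega)
  have hww : mnorm (W n) ≤ mnorm (W (n + 1)) / c₁ := by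
    rw [le_div_iff₀' hc₁]
    refine le_trans (mul_le_mul_of_nonneg_left ?_ hc₁.le) (hb n hn).1
    simpa using Real.rpow_le_rpow_of_exponent_le hw1 one_lt_gam.le
  set w := mnorm (W n)
  set w' := mnorm (W (n + 1))
  have hw0 : 0 < w := by linarith
  have hw'0 : 0 < w' := by linarith
  have hfirst : (skewNorm ξ T (castM (W (n + 1))) + skewNorm ξ T E) * skewNorm ξ T E' ≤
      C ^ 2 * e * (1 + e) * (w' / w) := by
    have h1 : e / w' ≤ e * w' :=
      (div_le_self he0.le hw2).trans (le_mul_of_one_le_right he0.le hw2)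
    have h2 : C * (e / w') ≤ C * (e * w') := mul_le_mul_of_nonneg_left h1 hC0.le
    have h3 := mul_le_mul (add_le_add hAn (hE.trans h2)) hE' (skewNorm_nonneg _ hT) (by positivity)
    refine h3.trans (le_of_eq ?_)
    field_simp
  have hsecond : skewNorm ξ T E * skewNorm ξ T (castM (W n)) ≤
      C ^ 2 * e / c₁ ^ 2 * (w' / w) := by
    have h3 := mul_le_mul hE hBn (skewNorm_nonneg _ hT) (by positivity)
    refine h3.trans ?_
    have h4 : w / w' ≤ w' / w / c₁ ^ 2 := by
      rw [div_div, div_le_div_iff₀ hw'0 (by positivity)]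
      have := pow_le_pow_left₀ hw0.le hww 2
      rw [div_pow, le_div_iff₀ (by positivity)] at this
      linarith
    have h5 := mul_le_mul_of_nonneg_left h4 (by positivity : 0 ≤ C ^ 2 * e)
    calc _ = C ^ 2 * e * (w / w') := by ring
      _ ≤ _ := h5
      _ = _ := by ring
  have hfinal : L * (w' / w) ≤ L / d * (1 / w ^ 2) *
      skewNorm ξ T (castM (W (n + 1)) * castM (W n)) := by
    have h1 := mul_le_mul_of_nonneg_left hlow (by positivity : 0 ≤ L / d * (1 / w ^ 2))
    refine le_trans (le_of_eq ?_) h1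
    field_simp
  have : L * (w' / w) = 2 * (C ^ 2 * e * (1 + e) * (w' / w)) +
      2 * (C ^ 2 * e / c₁ ^ 2 * (w' / w)) := by rw [hL]; ring
  rw [add_mul, one_mul]
  linarith

/-- For every factorization w_k = uv, with U = Φ(u) and V = Φ(v), one has
‖UV‖ ≍ ‖U‖‖V‖ with implied constants independent of k, u and v. -/
theorem stmt16 (ξ : ℝ) (W : ℕ → M2) (hξ : IsExtremal ξ) (hW : IsAssociated ξ W) :
    ∃ c₁ c₂ : ℝ, 0 < c₁ ∧ 0 < c₂ ∧
      ∀ k, 1 ≤ k → ∀ u v : List Bool, fw k = u ++ v →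
        c₁ * (mnorm (PhiW (W 1) (W 2) u) * mnorm (PhiW (W 1) (W 2) v)) ≤
          mnorm (PhiW (W 1) (W 2) u * PhiW (W 1) (W 2) v) ∧
        mnorm (PhiW (W 1) (W 2) u * PhiW (W 1) (W 2) v) ≤
          c₂ * (mnorm (PhiW (W 1) (W 2) u) * mnorm (PhiW (W 1) (W 2) v)) := by
  obtain ⟨T, K, hT, hK, hmul⟩ := exists_skewNorm_mul_skewNorm_le hξ hW
  obtain ⟨hfib, hub, -, c₁, _, _, _, _, _, hc₁, -, -, -, -, -, hb⟩ := hW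
  have hsum := (summable_inv_sq_of_growth hc₁
    (fun i hi => one_le_mnorm (ne_zero_of_det_ne_zero (hfib.1 i hi).2))
    (fun i hi => (hb i hi).1) hub).mul_left K
  have hε : ∀ n, 0 ≤ K * (1 / mnorm (W n) ^ 2) := fun n => by positivity
  set G : ℝ := Real.exp (∑' n, K * (1 / mnorm (W n) ^ 2)) with hG
  have hG0 : 0 < G := Real.exp_pos _
  have hprod : ∀ n, ∏ j ∈ Finset.range n, (1 + K * (1 / mnorm (W j) ^ 2)) ≤ G := by
    intro n
    calc _ ≤ ∏ j ∈ Finset.range n, Real.exp (K * (1 / mnorm (W j) ^ 2)) :=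
          Finset.prod_le_prod (fun j _ => by linarith [hε j])
            fun j _ => by rw [add_comm]; exact Real.add_one_le_exp _
      _ = Real.exp (∑ j ∈ Finset.range n, K * (1 / mnorm (W j) ^ 2)) := (Real.exp_sum _ _).symm
      _ ≤ G := Real.exp_le_exp.mpr (hsum.sum_le_tsum _ fun j _ => hε j)
  set C : ℝ := 1 + |ξ| + T * (1 + |ξ|) ^ 2 + 1 / T with hC
  set C' : ℝ := (1 + |ξ|) ^ 2 * (1 + T) + 1 / T with hC'
  have hC0 : 0 < C := by positivity
  have hC'0 : 0 < C' := by positivity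
  have hlo : ∀ A : M2, mnorm A ≤ C' * skewNorm ξ T (castM A) := fun A =>
    mnorm_le (abs_le_skewNorm (castM A) hT)
  have hhi : ∀ A : M2, skewNorm ξ T (castM A) ≤ C * mnorm A := fun A =>
    skewNorm_le _ hT (abs_le_mnorm A)
  have hm0 : ∀ A : M2, 0 ≤ mnorm A := fun A => (abs_nonneg _).trans (abs_le_mnorm A 0 0)
  refine ⟨1 / (C' ^ 2 * G * C), C' * C ^ 2, by positivity, by positivity, ?_⟩
  rintro k hk u v huv
  obtain ⟨n, rfl⟩ := Nat.exists_eq_add_of_le' hk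
  have hmain := skewNorm_PhiW_mul_le hfib hT hε hmul n u v huv
  set U := PhiW (W 1) (W 2) u
  set V := PhiW (W 1) (W 2) v
  have nUV := skewNorm_nonneg (ξ := ξ) (castM U * castM V) hT
  have hUV := hhi (U * V)
  have hUV' := hlo (U * V)
  rw [map_mul] at hUV hUV'
  constructor
  · rw [div_mul_eq_mul_div, one_mul, div_le_iff₀ (by positivity)]
    calc mnorm U * mnorm V
        ≤ (C' * skewNorm ξ T (castM U)) * (C' * skewNorm ξ T (castM V)) :=
          mul_le_mul (hlo U) (hlo V) (hm0 V) ((hm0 U).trans (hlo U))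
      _ = C' ^ 2 * (skewNorm ξ T (castM U) * skewNorm ξ T (castM V)) := by ring
      _ ≤ C' ^ 2 * (G * (C * mnorm (U * V))) := by
          refine mul_le_mul_of_nonneg_left (hmain.trans ?_) (by positivity)
          exact mul_le_mul (hprod n) hUV nUV hG0.le
      _ = mnorm (U * V) * (C' ^ 2 * G * C) := by ring
  · calc mnorm (U * V) ≤ C' * skewNorm ξ T (castM U * castM V) := hUV'
      _ ≤ C' * ((C * mnorm U) * (C * mnorm V)) := by
          refine mul_le_mul_of_nonneg_left ((skewNorm_mul_le _ _ hT).trans ?_) hC'0.le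
          exact mul_le_mul (hhi U) (hhi V) (skewNorm_nonneg _ hT) (by have := hm0 U; positivity)
      _ = C' * C ^ 2 * (mnorm U * mnorm V) := by ring
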